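/- Let a(z) = Σ_{j=0}^{r} a_j z^j be a primitive polynomial of degree r ≥ 1 over GF(2) with exactly c nonzero coefficients, let n = 2^r − 1, and let x ∈ {0,1}^n be a nonzero sequence satisfying the cyclic LFSR recursion with characteristic polynomial a(z), with window length k satisfying r ≤ k ≤ n. Suppose the minimum Hamming distance between distinct length-k cyclic windows of x equals d = 2t + 1 for some integer t ≥ 0. Then for every integer i with 1 ≤ i ≤ k and i·c² ≤ k − r, the inequality 2^r · K_t(ic)² · (∏_{j=0}^{i−1} (k − r − j·c²)) ≤ 2^k · i! · C(k,t) holds, where K_t(z) = Σ_{j=0}^{t} (−1)^j C(z,j)·C(k−z, t−j) is the Krawtchouk polynomial evaluated at the integer z = ic. -/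

import Mathlib

/-- Length-`k` cyclic window of the sequence `x` (indexed cyclically by `ZMod n`)
starting at phase `m`: `(x_m, x_{m+1}, …, x_{m+k-1})` with indices modulo `n`. -/
def win {α : Type*} {n : ℕ} (k : ℕ) (x : ZMod n → α) (m : ZMod n) : Fin k → α :=
  fun i => x (m + ((i : ℕ) : ZMod n))

/-- The monic polynomial `z^r + ∑_{i=0}^{r-1} a_i z^i` over GF(2). -/
noncomputable def lfsrPoly {r : ℕ} (a : Fin r → ZMod 2) : Polynomial (ZMod 2) :=
  Polynomial.X ^ r + ∑ i : Fin r, Polynomial.C (a i) * Polynomial.X ^ (i : ℕ)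

/-- `a(z) = z^r + ∑_{i=0}^{r-1} a_i z^i` is primitive over GF(2): it is irreducible and
the residue class of `z` in `GF(2)[z]/(a(z))` has multiplicative order `2^r - 1`. -/
def IsPrimitivePoly {r : ℕ} (a : Fin r → ZMod 2) : Prop :=
  Irreducible (lfsrPoly a) ∧ orderOf (AdjoinRoot.root (lfsrPoly a)) = 2 ^ r - 1

/-- The cyclic LFSR recursion `x_{r+j} = ∑_{i=0}^{r-1} a_i x_{i+j}` (mod 2),
for all `j`, indices cyclic modulo `n`. -/
def IsLFSR {n r : ℕ} (a : Fin r → ZMod 2) (x : ZMod n → ZMod 2) : Prop :=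
  ∀ j : ZMod n, x (j + (r : ZMod n)) = ∑ i : Fin r, a i * x (j + ((i : ℕ) : ZMod n))

/-- The nontrivial character of `ZMod 2`, with integer values. -/
def signChar (b : ZMod 2) : ℤ := if b = 0 then 1 else -1

/-- The character of `(ZMod 2)^k` attached to a set `u` of coordinates. -/
def cubeChar {k : ℕ} (u : Finset (Fin k)) (v : Fin k → ZMod 2) : ℤ := ∏ p ∈ u, signChar (v p)

/-- The indicator vector over `ZMod 2` of a set of coordinates. -/
def indVec {k : ℕ} (s : Finset (Fin k)) : Fin k → ZMod 2 := fun p => if p ∈ s then 1 else 0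

lemma signChar_zero : signChar 0 = 1 := rfl

lemma signChar_add (a b : ZMod 2) : signChar (a + b) = signChar a * signChar b := by
  revert a b; decide

lemma signChar_sum {ι : Type*} (s : Finset ι) (f : ι → ZMod 2) :
    signChar (∑ i ∈ s, f i) = ∏ i ∈ s, signChar (f i) := by
  classical
  induction s using Finset.induction_on with
  | empty => rfl
  | insert a s ha ih => rw [Finset.sum_insert ha, Finset.prod_insert ha, signChar_add, ih]

lemma cubeChar_add {k : ℕ} (u : Finset (Fin k)) (v w : Fin k → ZMod 2) :
    cubeChar u (v + w) = cubeChar u v * cubeChar u w := by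
  simp only [cubeChar, Pi.add_apply, signChar_add, Finset.prod_mul_distrib]

lemma sum_cubeChar {k : ℕ} (v : Fin k → ZMod 2) :
    ∑ u : Finset (Fin k), cubeChar u v = if v = 0 then 2 ^ k else 0 := by
  have h : ∑ u : Finset (Fin k), cubeChar u v = ∏ p, (1 + signChar (v p)) := by
    rw [Finset.prod_one_add, Finset.powerset_univ]; rfl
  rw [h]
  split_ifs with hv
  · subst hv
    simp [signChar_zero]
  · obtain ⟨p, hp⟩ := Function.ne_iff.mp hv
    refine Finset.prod_eq_zero (Finset.mem_univ p) ?_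
    have hp' : v p ≠ 0 := hp
    simp [signChar, hp']

lemma add_eq_zero_iff_eq_zmod_two {k : ℕ} (v w : Fin k → ZMod 2) : v + w = 0 ↔ v = w := by
  simp only [funext_iff, Pi.add_apply, Pi.zero_apply, CharTwo.add_eq_zero]

/-- Parseval's identity for the indicator function of a subset of the cube. -/
lemma sum_sq_sum_cubeChar {k : ℕ} (T : Finset (Fin k → ZMod 2)) :
    ∑ u : Finset (Fin k), (∑ v ∈ T, cubeChar u v) ^ 2 = 2 ^ k * (T.card : ℤ) := by
  have h : ∀ u : Finset (Fin k), (∑ v ∈ T, cubeChar u v) ^ 2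
      = ∑ v ∈ T, ∑ w ∈ T, cubeChar u (v + w) := by
    intro u
    rw [sq, Finset.sum_mul_sum]
    simp only [cubeChar_add]
  simp only [h]
  rw [Finset.sum_comm]
  have h2 : ∀ v ∈ T, ∑ u : Finset (Fin k), ∑ w ∈ T, cubeChar u (v + w) = 2 ^ k := by
    intro v hv
    rw [Finset.sum_comm]
    simp only [sum_cubeChar, add_eq_zero_iff_eq_zmod_two]
    simp [hv]
  rw [Finset.sum_congr rfl h2]
  simp [mul_comm]

lemma coeff_one_sub_X_pow (m j : ℕ) :
    ((1 - Polynomial.X : Polynomial ℤ) ^ m).coeff j = (-1) ^ j * (m.choose j : ℤ) := by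
  have h : (1 - Polynomial.X : Polynomial ℤ) ^ m
      = ((1 + Polynomial.X) ^ m : Polynomial ℤ).comp (Polynomial.C (-1) * Polynomial.X) := by
    simp [sub_eq_add_neg]
  rw [h, Polynomial.comp_C_mul_X_coeff, Polynomial.coeff_one_add_X_pow]
  ring

/-- The character sum over the sphere of radius `t` is a Krawtchouk value. -/
lemma sum_powersetCard_cubeChar_indVec {k t : ℕ} (u : Finset (Fin k)) :
    ∑ s ∈ Finset.powersetCard t Finset.univ, cubeChar u (indVec s)
      = ∑ j ∈ Finset.range (t + 1),
          (-1 : ℤ) ^ j * (u.card.choose j : ℤ) * ((k - u.card).choose (t - j) : ℤ) := by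
  open Polynomial in
  have hchar : ∀ s : Finset (Fin k),
      cubeChar u (indVec s) = ∏ p ∈ s, (if p ∈ u then (-1 : ℤ) else 1) := by
    intro s
    have h1 : ∀ p, signChar (indVec s p) = if p ∈ s then -1 else 1 := by
      intro p
      by_cases hp : p ∈ s <;> simp [indVec, signChar, hp]
    simp only [cubeChar, h1]
    rw [← Finset.prod_filter, ← Finset.prod_filter]
    congr 1
    ext p
    simp [and_comm]
  have hprod : ∏ p : Fin k, (1 + C (if p ∈ u then (-1 : ℤ) else 1) * X)
      = (1 - X) ^ u.card * (1 + X) ^ (k - u.card) := by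
    have h1 : ∀ p : Fin k, (1 + C (if p ∈ u then (-1 : ℤ) else 1) * X)
        = if p ∈ u then (1 - X) else (1 + X) := by
      intro p
      split_ifs <;> simp [sub_eq_add_neg]
    simp only [h1]
    rw [Finset.prod_ite, Finset.prod_const, Finset.prod_const]
    congr 2
    · simp
    · rw [Finset.filter_not, Finset.card_sdiff]
      simp
  have hcoeff := congrArg (fun q => coeff q t) hprod
  simp only [Finset.prod_one_add, finsetSum_coeff, Finset.prod_mul_distrib,
    Finset.prod_const, ← map_prod, coeff_C_mul, coeff_X_pow] at hcoeff
  simp only [coeff_mul, coeff_one_sub_X_pow, coeff_one_add_X_pow] at hcoeff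
  rw [Finset.Nat.sum_antidiagonal_eq_sum_range_succ
    (fun a b => (-1 : ℤ) ^ a * (u.card.choose a : ℤ) * ((k - u.card).choose b : ℤ))] at hcoeff
  rw [← hcoeff]
  simp only [hchar, mul_ite, mul_one, mul_zero]
  rw [← Finset.sum_filter]
  refine Finset.sum_congr ?_ fun _ _ => rfl
  ext s
  simp [Finset.mem_powersetCard, eq_comm]

/-- The `i`-element index sets whose members `P j` are pairwise disjoint. -/
def disjointFamilies {ι κ : Type*} [Fintype ι] [DecidableEq ι] [DecidableEq κ]
    (P : ι → Finset κ) (i : ℕ) : Finset (Finset ι) :=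
  {M ∈ Finset.powersetCard i Finset.univ | ∀ a ∈ M, ∀ b ∈ M, a ≠ b → Disjoint (P a) (P b)}

lemma mem_disjointFamilies {ι κ : Type*} [Fintype ι] [DecidableEq ι] [DecidableEq κ]
    {P : ι → Finset κ} {i : ℕ} {M : Finset ι} : M ∈ disjointFamilies P i ↔
      M.card = i ∧ ∀ a ∈ M, ∀ b ∈ M, a ≠ b → Disjoint (P a) (P b) := by
  simp [disjointFamilies]

lemma card_biUnion_of_mem_disjointFamilies {ι κ : Type*} [Fintype ι] [DecidableEq ι]
    [DecidableEq κ] {P : ι → Finset κ} {i c : ℕ} (hP : ∀ j, (P j).card = c) {M : Finset ι}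
    (hM : M ∈ disjointFamilies P i) : (M.biUnion P).card = i * c := by
  rw [mem_disjointFamilies] at hM
  rw [Finset.card_biUnion (fun a ha b hb => hM.2 a ha b hb)]
  simp [hP, hM.1]

lemma card_disjointFamilies_succ {ι κ : Type*} [Fintype ι] [DecidableEq ι] [DecidableEq κ]
    (P : ι → Finset κ) (c : ℕ) (hc : 1 ≤ c) (hP : ∀ j, (P j).card = c)
    (hdeg : ∀ p, (Finset.univ.filter fun j => p ∈ P j).card ≤ c) (i : ℕ) :
    (disjointFamilies P i).card * (Fintype.card ι - i * c ^ 2)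
      ≤ (disjointFamilies P (i + 1)).card * (i + 1) := by
  refine Finset.card_mul_le_card_mul (fun M M' => M ⊆ M') ?_ ?_
  · intro M hM
    have hM' := mem_disjointFamilies.mp hM
    set bad : Finset ι := (M.biUnion P).biUnion fun p => Finset.univ.filter fun j => p ∈ P j
      with hbad
    have hbadcard : bad.card ≤ i * c ^ 2 := by
      refine (Finset.card_biUnion_le_card_mul _ _ c fun p _ => hdeg p).trans ?_
      rw [card_biUnion_of_mem_disjointFamilies hP hM]
      exact le_of_eq (by ring)
    have hgood : ∀ j ∈ badᶜ, ∀ m ∈ M, Disjoint (P m) (P j) := by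
      intro j hj m hm
      rw [Finset.disjoint_left]
      intro p hp hpj
      refine Finset.mem_compl.mp hj (Finset.mem_biUnion.mpr ⟨p, ?_, by simpa using hpj⟩)
      exact Finset.mem_biUnion.mpr ⟨m, hm, hp⟩
    have hnot : ∀ j ∈ badᶜ, j ∉ M := by
      intro j hj hjM
      have h := hgood j hj j hjM
      rw [disjoint_self, Finset.bot_eq_empty] at h
      have := hP j
      rw [h, Finset.card_empty] at this
      omega
    calc Fintype.card ι - i * c ^ 2 ≤ badᶜ.card := by
          rw [Finset.card_compl]; omega
      _ ≤ _ := by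
          refine Finset.card_le_card_of_injOn (fun j => insert j M) ?_ ?_
          · intro j hj
            have hj' : j ∈ badᶜ := hj
            simp only [Finset.bipartiteAbove, Finset.coe_filter, Set.mem_ofPred_eq]
            refine ⟨mem_disjointFamilies.mpr ⟨?_, ?_⟩, Finset.subset_insert _ _⟩
            · rw [Finset.card_insert_of_notMem (hnot j hj'), hM'.1]
            · intro a ha b hb hab
              rcases Finset.mem_insert.mp ha with haj | haM
              · rcases Finset.mem_insert.mp hb with hbj | hbM
                · exact absurd (haj.trans hbj.symm) hab
                · exact haj ▸ (hgood _ hj' b hbM).symm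
              · rcases Finset.mem_insert.mp hb with hbj | hbM
                · exact hbj ▸ hgood _ hj' a haM
                · exact hM'.2 a haM b hbM hab
          · intro j hj j' _ hjj
            have hmem : j ∈ insert j' M := by
              have : insert j M = insert j' M := hjj
              rw [← this]; exact Finset.mem_insert_self _ _
            rcases Finset.mem_insert.mp hmem with h | h
            · exact h
            · exact absurd h (hnot j hj)
  · intro M' hM'
    have h' := mem_disjointFamilies.mp hM'
    calc _ ≤ (Finset.powersetCard i M').card := by
          refine Finset.card_le_card ?_
          intro M hM
          simp only [Finset.bipartiteBelow, Finset.mem_filter] at hM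
          exact Finset.mem_powersetCard.mpr ⟨hM.2, (mem_disjointFamilies.mp hM.1).1⟩
      _ = i + 1 := by
          rw [Finset.card_powersetCard, h'.1, Nat.choose_succ_self_right]

lemma prod_le_card_disjointFamilies {ι κ : Type*} [Fintype ι] [DecidableEq ι] [DecidableEq κ]
    (P : ι → Finset κ) (c : ℕ) (hc : 1 ≤ c) (hP : ∀ j, (P j).card = c)
    (hdeg : ∀ p, (Finset.univ.filter fun j => p ∈ P j).card ≤ c) (i : ℕ) :
    ∏ j ∈ Finset.range i, (Fintype.card ι - j * c ^ 2)
      ≤ (disjointFamilies P i).card * i.factorial := by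
  induction i with
  | zero =>
    have : ∅ ∈ disjointFamilies P 0 := mem_disjointFamilies.mpr (by simp)
    simpa using Finset.card_pos.mpr ⟨_, this⟩
  | succ i ih =>
    rw [Finset.prod_range_succ, Nat.factorial_succ]
    calc _ ≤ (disjointFamilies P i).card * i.factorial * (Fintype.card ι - i * c ^ 2) :=
          Nat.mul_le_mul_right _ ih
      _ = (disjointFamilies P i).card * (Fintype.card ι - i * c ^ 2) * i.factorial := by ring
      _ ≤ (disjointFamilies P (i + 1)).card * (i + 1) * i.factorial :=
          Nat.mul_le_mul_right _ (card_disjointFamilies_succ P c hc hP hdeg i)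
      _ = _ := by ring

lemma biUnion_injOn_disjointFamilies {ι κ : Type*} [Fintype ι] [LinearOrder ι] [DecidableEq κ]
    (P : ι → Finset κ) (top : ι → κ) (htop : ∀ j, top j ∈ P j)
    (hle : ∀ j j', top j ∈ P j' → j ≤ j') (i : ℕ) :
    Set.InjOn (fun M : Finset ι => M.biUnion P) (disjointFamilies P i) := by
  have key : ∀ M ∈ disjointFamilies P i, ∀ M' : Finset ι, M.biUnion P = M'.biUnion P →
      ∀ j ∈ M, j ∉ M' → ∃ j' > j, j' ∈ M' ∧ j' ∉ M := by
    intro M hM M' heq j hj hj'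
    have h1 : top j ∈ M'.biUnion P := by
      rw [← heq]; exact Finset.mem_biUnion.mpr ⟨j, hj, htop j⟩
    obtain ⟨j', hj'M, hjj'⟩ := Finset.mem_biUnion.mp h1
    have hne : j ≠ j' := by rintro rfl; exact hj' hj'M
    refine ⟨j', lt_of_le_of_ne (hle _ _ hjj') hne, hj'M, fun hmem => ?_⟩
    exact Finset.disjoint_left.mp ((mem_disjointFamilies.mp hM).2 j hj j' hmem hne)
      (htop j) hjj'
  intro M hM M' hM' heq
  by_contra hne
  have hnonempty : (symmDiff M M').Nonempty := by
    rw [Finset.nonempty_iff_ne_empty]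
    intro h
    exact hne (symmDiff_eq_bot.mp h)
  obtain ⟨j, hj, hmax⟩ := Finset.exists_max_image _ id hnonempty
  rcases Finset.mem_symmDiff.mp hj with ⟨h1, h2⟩ | ⟨h1, h2⟩
  · obtain ⟨j', hlt, h3, h4⟩ := key M hM M' heq j h1 h2
    exact absurd (hmax j' (Finset.mem_symmDiff.mpr (Or.inr ⟨h3, h4⟩))) (not_le.mpr hlt)
  · obtain ⟨j', hlt, h3, h4⟩ := key M' hM' M heq.symm j h1 h2
    exact absurd (hmax j' (Finset.mem_symmDiff.mpr (Or.inl ⟨h3, h4⟩))) (not_le.mpr hlt)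

lemma hammingDist_add_indVec {k : ℕ} (v : Fin k → ZMod 2) (s : Finset (Fin k)) :
    hammingDist v (v + indVec s) = s.card := by
  unfold hammingDist
  congr 1
  ext p
  by_cases hp : p ∈ s <;> simp [indVec, hp]

lemma indVec_injective {k : ℕ} : Function.Injective (indVec (k := k)) := by
  intro s s' h
  ext p
  have := congrFun h p
  by_cases hp : p ∈ s <;> by_cases hp' : p ∈ s' <;> simp_all [indVec]

/-- For a code `C` with minimum distance at least `2t + 1`, coordinate sets of size `m` on which
every codeword has even weight are rare whenever the Krawtchouk value `K_t(m)` is nonzero. -/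
lemma card_mul_krawtchouk_sq_le {k t m : ℕ} (C : Finset (Fin k → ZMod 2))
    (hC : C.Nonempty)
    (hdist : ∀ v ∈ C, ∀ w ∈ C, v ≠ w → 2 * t + 1 ≤ hammingDist v w)
    (D : Finset (Finset (Fin k))) (hcard : ∀ u ∈ D, u.card = m)
    (horth : ∀ u ∈ D, ∀ v ∈ C, cubeChar u v = 1) :
    (C.card : ℤ) *
        (∑ j ∈ Finset.range (t + 1),
          (-1 : ℤ) ^ j * (m.choose j : ℤ) * ((k - m).choose (t - j) : ℤ)) ^ 2 * (D.card : ℤ)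
      ≤ 2 ^ k * (k.choose t : ℤ) := by
  set K := ∑ j ∈ Finset.range (t + 1),
    (-1 : ℤ) ^ j * (m.choose j : ℤ) * ((k - m).choose (t - j) : ℤ) with hK
  have hinj : Set.InjOn (fun q : (Fin k → ZMod 2) × Finset (Fin k) => q.1 + indVec q.2)
      ↑(C ×ˢ Finset.powersetCard t (Finset.univ : Finset (Fin k))) := by
    rintro ⟨v, s⟩ h1 ⟨w, s'⟩ h2 heq
    simp only [Finset.coe_product, Set.mem_prod, Finset.mem_coe, Finset.mem_powersetCard] at h1 h2
    have heq' : v + indVec s = w + indVec s' := heq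
    by_cases hvw : v = w
    · subst hvw
      rw [indVec_injective (add_left_cancel heq')]
    · have hlow := hdist v h1.1 w h2.1 hvw
      have htri := hammingDist_triangle v (v + indVec s) w
      rw [hammingDist_add_indVec, heq', hammingDist_comm (w + indVec s'),
        hammingDist_add_indVec, h1.2.2, h2.2.2] at htri
      omega
  set T := (C ×ˢ Finset.powersetCard t Finset.univ).image
    (fun q : (Fin k → ZMod 2) × Finset (Fin k) => q.1 + indVec q.2) with hT
  have hTcard : T.card = C.card * k.choose t := by
    rw [hT, Finset.card_image_of_injOn hinj, Finset.card_product, Finset.card_powersetCard]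
    simp
  have hsum : ∀ u ∈ D, ∑ v ∈ T, cubeChar u v = C.card * K := by
    intro u hu
    rw [hT, Finset.sum_image hinj, Finset.sum_product]
    have h : ∀ v ∈ C, ∑ s ∈ Finset.powersetCard t Finset.univ, cubeChar u (v + indVec s) = K := by
      intro v hv
      simp only [cubeChar_add, horth u hu v hv, one_mul]
      rw [sum_powersetCard_cubeChar_indVec, hcard u hu]
    rw [Finset.sum_congr rfl h]
    simp
  have hle : ∑ u ∈ D, (∑ v ∈ T, cubeChar u v) ^ 2 ≤ 2 ^ k * (T.card : ℤ) := by
    rw [← sum_sq_sum_cubeChar]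
    exact Finset.sum_le_sum_of_subset_of_nonneg (Finset.subset_univ _) fun _ _ _ => sq_nonneg _
  rw [Finset.sum_congr rfl fun u hu => by rw [hsum u hu], hTcard] at hle
  have hpos : (0 : ℤ) < C.card := by exact_mod_cast hC.card_pos
  refine le_of_mul_le_mul_left ?_ hpos
  calc _ = ∑ u ∈ D, ((C.card : ℤ) * K) ^ 2 := by
        rw [Finset.sum_const, nsmul_eq_mul]; ring
    _ ≤ _ := hle
    _ = _ := by push_cast; ring

/-- The linear recursion on finite words of length `k`. -/
def IsLFSRWord {k r : ℕ} (a : Fin r → ZMod 2) (w : Fin k → ZMod 2) : Prop :=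
  ∀ (j : ℕ) (hj : j + r < k), w ⟨j + r, hj⟩ = ∑ l : Fin r, a l * w ⟨j + l, by omega⟩

lemma isLFSRWord_win {n r k : ℕ} {a : Fin r → ZMod 2} {x : ZMod n → ZMod 2}
    (hrec : IsLFSR a x) (m : ZMod n) : IsLFSRWord a (win k x m) := by
  intro j hj
  have := hrec (m + j)
  simpa [win, add_assoc] using this

lemma IsLFSRWord.add {k r : ℕ} {a : Fin r → ZMod 2} {v w : Fin k → ZMod 2}
    (hv : IsLFSRWord a v) (hw : IsLFSRWord a w) : IsLFSRWord a (v + w) := by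
  intro j hj
  simp only [Pi.add_apply, mul_add, Finset.sum_add_distrib]
  rw [hv j hj, hw j hj]

lemma IsLFSRWord.ext {k r : ℕ} (hrk : r ≤ k) {a : Fin r → ZMod 2} {v w : Fin k → ZMod 2}
    (hv : IsLFSRWord a v) (hw : IsLFSRWord a w)
    (h : ∀ l : Fin r, v (Fin.castLE hrk l) = w (Fin.castLE hrk l)) : v = w := by
  have key : ∀ (j : ℕ) (hj : j < k), v ⟨j, hj⟩ = w ⟨j, hj⟩ := by
    intro j
    induction j using Nat.strong_induction_on with
    | _ j ih =>
      intro hj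
      rcases lt_or_ge j r with hjr | hjr
      · exact h ⟨j, hjr⟩
      · obtain ⟨j, rfl⟩ := Nat.exists_eq_add_of_le' hjr
        rw [hv j hj, hw j hj]
        exact Finset.sum_congr rfl fun l _ => by rw [ih (j + l) (by omega)]
  exact funext fun p => key p p.2

lemma win_ne_zero {n r k : ℕ} [NeZero n] (hrk : r ≤ k) {a : Fin r → ZMod 2}
    {x : ZMod n → ZMod 2} (hx : x ≠ 0) (hrec : IsLFSR a x) (m : ZMod n) : win k x m ≠ 0 := by
  intro h
  have key : ∀ j : ℕ, x (m + j) = 0 := by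
    intro j
    induction j using Nat.strong_induction_on with
    | _ j ih =>
      rcases lt_or_ge j r with hjr | hjr
      · exact congrFun h ⟨j, by omega⟩
      · obtain ⟨j, rfl⟩ := Nat.exists_eq_add_of_le' hjr
        have := hrec (m + j)
        rw [add_assoc, ← Nat.cast_add] at this
        rw [this]
        refine Finset.sum_eq_zero fun l _ => ?_
        rw [add_assoc, ← Nat.cast_add, ih (j + l) (by omega), mul_zero]
  refine hx (funext fun p => ?_)
  have := key (p - m).val
  simpa using this

/-- The windows of an LFSR sequence of period `2^r - 1` together with the zero word. -/
def windowCode {n : ℕ} [NeZero n] (k : ℕ) (x : ZMod n → ZMod 2) : Finset (Fin k → ZMod 2) :=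
  insert 0 (Finset.univ.image (win k x))

lemma isLFSRWord_of_mem_windowCode {n r k : ℕ} [NeZero n] {a : Fin r → ZMod 2}
    {x : ZMod n → ZMod 2} (hrec : IsLFSR a x) {w : Fin k → ZMod 2}
    (hw : w ∈ windowCode k x) : IsLFSRWord a w := by
  rcases Finset.mem_insert.mp hw with rfl | hw
  · intro j hj; simp
  · obtain ⟨m, -, rfl⟩ := Finset.mem_image.mp hw
    exact isLFSRWord_win hrec m

lemma card_windowCode {n r k : ℕ} [NeZero n] (hrk : r ≤ k) {a : Fin r → ZMod 2}
    {x : ZMod n → ZMod 2} (hx : x ≠ 0) (hrec : IsLFSR a x)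
    (hinj : Function.Injective (win k x)) : (windowCode k x).card = n + 1 := by
  rw [windowCode, Finset.card_insert_of_notMem, Finset.card_image_of_injective _ hinj,
    Finset.card_univ, ZMod.card]
  rw [Finset.mem_image]
  rintro ⟨m, -, hm⟩
  exact win_ne_zero hrk hx hrec m hm

lemma mem_windowCode_iff {n r k : ℕ} [NeZero n] (hn : n + 1 = 2 ^ r) (hrk : r ≤ k)
    {a : Fin r → ZMod 2} {x : ZMod n → ZMod 2} (hx : x ≠ 0) (hrec : IsLFSR a x)
    (hinj : Function.Injective (win k x)) {w : Fin k → ZMod 2} :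
    w ∈ windowCode k x ↔ IsLFSRWord a w := by
  classical
  refine ⟨isLFSRWord_of_mem_windowCode hrec, fun hw => ?_⟩
  have hsub : windowCode k x ⊆ Finset.univ.filter fun w => IsLFSRWord a w := fun v hv =>
    Finset.mem_filter.mpr ⟨Finset.mem_univ _, isLFSRWord_of_mem_windowCode hrec hv⟩
  have hcard : (Finset.univ.filter fun w : Fin k → ZMod 2 => IsLFSRWord a w).card
      ≤ (windowCode k x).card := by
    rw [card_windowCode hrk hx hrec hinj, hn]
    calc _ ≤ (Finset.univ : Finset (Fin r → ZMod 2)).card := by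
          refine Finset.card_le_card_of_injOn (fun w l => w (Fin.castLE hrk l))
            (fun _ _ => Finset.mem_coe.mpr (Finset.mem_univ _)) ?_
          intro v hv v' hv' h
          exact IsLFSRWord.ext hrk (Finset.mem_filter.mp hv).2 (Finset.mem_filter.mp hv').2
            fun l => congrFun h l
      _ = 2 ^ r := by simp [ZMod.card]
  rw [Finset.eq_of_subset_of_card_le hsub hcard]
  exact Finset.mem_filter.mpr ⟨Finset.mem_univ _, hw⟩

lemma le_hammingDist_of_mem_windowCode {n r k d : ℕ} [NeZero n] (hn : n + 1 = 2 ^ r)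
    (hrk : r ≤ k) {a : Fin r → ZMod 2} {x : ZMod n → ZMod 2} (hx : x ≠ 0) (hrec : IsLFSR a x)
    (hinj : Function.Injective (win k x)) (hnontriv : Nontrivial (ZMod n))
    (hd : ∀ m₁ m₂ : ZMod n, m₁ ≠ m₂ → d ≤ hammingDist (win k x m₁) (win k x m₂)) :
    ∀ v ∈ windowCode k x, ∀ w ∈ windowCode k x, v ≠ w → d ≤ hammingDist v w := by
  have hzero : ∀ m : ZMod n, d ≤ hammingDist 0 (win k x m) := by
    intro m
    obtain ⟨m₁, hm₁⟩ := exists_ne m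
    have hmem : win k x m + win k x m₁ ∈ windowCode k x :=
      (mem_windowCode_iff hn hrk hx hrec hinj).mpr
        ((isLFSRWord_win hrec m).add (isLFSRWord_win hrec m₁))
    rcases Finset.mem_insert.mp hmem with h | h
    · exact absurd (hinj ((add_eq_zero_iff_eq_zmod_two _ _).mp h)).symm hm₁
    · obtain ⟨m₂, -, hm₂⟩ := Finset.mem_image.mp h
      have hne : m₁ ≠ m₂ := by
        rintro rfl
        exact win_ne_zero hrk hx hrec m (by simpa using hm₂)
      have := hd m₁ m₂ hne
      rw [hm₂] at this
      refine this.trans (le_of_eq ?_)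
      unfold hammingDist
      congr 1
      ext p
      simp [eq_comm]
  intro v hv w hw hvw
  rcases Finset.mem_insert.mp hv with rfl | hv
  · rcases Finset.mem_insert.mp hw with rfl | hw
    · exact absurd rfl hvw
    · obtain ⟨m, -, rfl⟩ := Finset.mem_image.mp hw
      exact hzero m
  · obtain ⟨m, -, rfl⟩ := Finset.mem_image.mp hv
    rcases Finset.mem_insert.mp hw with rfl | hw
    · rw [hammingDist_comm]; exact hzero m
    · obtain ⟨m', -, rfl⟩ := Finset.mem_image.mp hw
      exact hd m m' fun h => hvw (by rw [h])

/-- The support of the parity check `z^j a(z)` on words of length `k`. -/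
def checkSupport {k r : ℕ} (a : Fin r → ZMod 2) (j : Fin (k - r)) : Finset (Fin k) :=
  insert ⟨j + r, by omega⟩
    ((Finset.univ.filter fun l : Fin r => a l ≠ 0).image fun l : Fin r => ⟨j + l, by omega⟩)

lemma card_checkSupport {k r : ℕ} (a : Fin r → ZMod 2) (j : Fin (k - r)) :
    (checkSupport a j).card = (Finset.univ.filter fun l : Fin r => a l ≠ 0).card + 1 := by
  rw [checkSupport, Finset.card_insert_of_notMem, Finset.card_image_of_injective]
  · intro l l' h
    simp only [Fin.mk.injEq] at h
    exact Fin.ext (by omega)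
  · rw [Finset.mem_image]
    rintro ⟨l, -, hl⟩
    simp only [Fin.mk.injEq] at hl
    omega

lemma top_mem_checkSupport {k r : ℕ} (a : Fin r → ZMod 2) (j : Fin (k - r)) :
    (⟨j + r, by omega⟩ : Fin k) ∈ checkSupport a j :=
  Finset.mem_insert_self _ _

lemma le_of_top_mem_checkSupport {k r : ℕ} {a : Fin r → ZMod 2} {j j' : Fin (k - r)}
    (h : (⟨j + r, by omega⟩ : Fin k) ∈ checkSupport a j') : j ≤ j' := by
  rw [Fin.le_def]
  rcases Finset.mem_insert.mp h with h | h
  · simp only [Fin.mk.injEq] at h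
    omega
  · obtain ⟨l, -, hl⟩ := Finset.mem_image.mp h
    simp only [Fin.mk.injEq] at hl
    omega

lemma card_filter_mem_checkSupport_le {k r : ℕ} (a : Fin r → ZMod 2) (p : Fin k) :
    (Finset.univ.filter fun j : Fin (k - r) => p ∈ checkSupport a j).card
      ≤ (Finset.univ.filter fun l : Fin r => a l ≠ 0).card + 1 := by
  have hle : (insert r ((Finset.univ.filter fun l : Fin r => a l ≠ 0).image
      fun l : Fin r => (l : ℕ))).card ≤ (Finset.univ.filter fun l : Fin r => a l ≠ 0).card + 1 :=
    (Finset.card_insert_le _ _).trans (Nat.add_le_add_right Finset.card_image_le 1)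
  have hmem : ∀ j : Fin (k - r), p ∈ checkSupport a j → (j : ℕ) ≤ p ∧ (p : ℕ) - j ∈
      insert r ((Finset.univ.filter fun l : Fin r => a l ≠ 0).image fun l : Fin r => (l : ℕ)) := by
    intro j hj
    rcases Finset.mem_insert.mp hj with rfl | hj
    · simp
    · obtain ⟨l, hl, rfl⟩ := Finset.mem_image.mp hj
      refine ⟨by simp, Finset.mem_insert_of_mem (Finset.mem_image.mpr ⟨l, hl, by simp⟩)⟩
  refine le_trans (Finset.card_le_card_of_injOn (fun j => (p : ℕ) - j) ?_ ?_) hle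
  · intro j hj
    exact Finset.mem_coe.mpr (hmem j (Finset.mem_filter.mp hj).2).2
  · intro j hj j' hj' h
    have h1 := (hmem j (Finset.mem_filter.mp hj).2).1
    have h2 := (hmem j' (Finset.mem_filter.mp hj').2).1
    have h3 : (p : ℕ) - j = p - j' := h
    exact Fin.ext (by omega)

lemma cubeChar_checkSupport {k r : ℕ} {a : Fin r → ZMod 2} {w : Fin k → ZMod 2}
    (hw : IsLFSRWord a w) (j : Fin (k - r)) : cubeChar (checkSupport a j) w = 1 := by
  rw [cubeChar, checkSupport, Finset.prod_insert, Finset.prod_image, hw j (by omega)]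
  · have h : ∑ l : Fin r, a l * w ⟨j + l, by omega⟩
        = ∑ l ∈ Finset.univ.filter (fun l : Fin r => a l ≠ 0), w ⟨j + l, by omega⟩ := by
      rw [Finset.sum_filter]
      refine Finset.sum_congr rfl fun l _ => ?_
      have hmul : ∀ b y : ZMod 2, b * y = if b ≠ 0 then y else 0 := by decide
      exact hmul _ _
    rw [h, ← signChar_sum, ← signChar_add, CharTwo.add_self_eq_zero, signChar_zero]
  · intro l _ l' _ h
    simp only [Fin.mk.injEq] at h
    exact Fin.ext (by omega)
  · rw [Finset.mem_image]
    rintro ⟨l, -, hl⟩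
    simp only [Fin.mk.injEq] at hl
    omega

theorem stmt6 (r n k t : ℕ) (hr : 1 ≤ r) (hn : n = 2 ^ r - 1)
    (hrk : r ≤ k) (hkn : k ≤ n)
    (a : Fin r → ZMod 2) (hprim : IsPrimitivePoly a)
    (x : ZMod n → ZMod 2) (hx : x ≠ 0) (hrec : IsLFSR a x)
    (hminLB : ∀ m₁ m₂ : ZMod n, m₁ ≠ m₂ →
      2 * t + 1 ≤ hammingDist (win k x m₁) (win k x m₂))
    (hminEq : ∃ m₁ m₂ : ZMod n, m₁ ≠ m₂ ∧
      hammingDist (win k x m₁) (win k x m₂) = 2 * t + 1)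
    (c : ℕ) (hc : c = (Finset.univ.filter fun i : Fin r => a i ≠ 0).card + 1)
    (i : ℕ) (hi1 : 1 ≤ i) (hik : i ≤ k) (hic : i * c ^ 2 ≤ k - r) :
    (2 ^ r : ℤ) *
        (∑ j ∈ Finset.range (t + 1),
          (-1 : ℤ) ^ j * ((i * c).choose j : ℤ) * ((k - i * c).choose (t - j) : ℤ)) ^ 2 *
        (∏ j ∈ Finset.range i, ((k : ℤ) - (r : ℤ) - (j : ℤ) * (c : ℤ) ^ 2)) ≤
      2 ^ k * (Nat.factorial i : ℤ) * (k.choose t : ℤ) := by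
  have hpow : 1 ≤ 2 ^ r := Nat.one_le_two_pow
  have hpow2 : 2 ≤ 2 ^ r := by
    calc 2 = 2 ^ 1 := rfl
      _ ≤ 2 ^ r := Nat.pow_le_pow_right (by norm_num) hr
  have hn1 : n + 1 = 2 ^ r := by omega
  have : NeZero n := ⟨by omega⟩
  have hinj : Function.Injective (win k x) := by
    intro m₁ m₂ h
    by_contra hne
    have := hminLB m₁ m₂ hne
    rw [h, hammingDist_self] at this
    omega
  have hnontriv : Nontrivial (ZMod n) := by
    obtain ⟨m₁, m₂, hne, -⟩ := hminEq
    exact ⟨m₁, m₂, hne⟩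
  set P : Fin (k - r) → Finset (Fin k) := checkSupport a with hPdef
  have hP : ∀ j, (P j).card = c := fun j => by rw [hc]; exact card_checkSupport a j
  have hdeg : ∀ p, (Finset.univ.filter fun j => p ∈ P j).card ≤ c := fun p => by
    rw [hc]; exact card_filter_mem_checkSupport_le a p
  have hcount := prod_le_card_disjointFamilies P c (by omega) hP hdeg i
  set D := (disjointFamilies P i).image fun M => M.biUnion P with hD
  have hDcard : D.card = (disjointFamilies P i).card :=
    Finset.card_image_of_injOn <| biUnion_injOn_disjointFamilies P
      (fun j => ⟨j + r, by omega⟩) (top_mem_checkSupport a)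
      (fun _ _ h => le_of_top_mem_checkSupport h) i
  rw [← hDcard, Fintype.card_fin] at hcount
  have hmain := card_mul_krawtchouk_sq_le (t := t) (m := i * c) (windowCode k x)
    ⟨0, Finset.mem_insert_self _ _⟩
    (le_hammingDist_of_mem_windowCode hn1 hrk hx hrec hinj hnontriv hminLB) D
    (by
      intro u hu
      obtain ⟨M, hM, rfl⟩ := Finset.mem_image.mp hu
      exact card_biUnion_of_mem_disjointFamilies hP hM)
    (by
      intro u hu v hv
      obtain ⟨M, hM, rfl⟩ := Finset.mem_image.mp hu
      rw [cubeChar, Finset.prod_biUnion (fun a ha b hb => (mem_disjointFamilies.mp hM).2 a ha b hb)]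
      exact Finset.prod_eq_one fun j _ =>
        cubeChar_checkSupport (isLFSRWord_of_mem_windowCode hrec hv) j)
  rw [card_windowCode hrk hx hrec hinj, hn1] at hmain
  push_cast at hmain
  set K := ∑ j ∈ Finset.range (t + 1),
    (-1 : ℤ) ^ j * ((i * c).choose j : ℤ) * ((k - i * c).choose (t - j) : ℤ) with hK
  have hprod : ∏ j ∈ Finset.range i, ((k : ℤ) - (r : ℤ) - (j : ℤ) * (c : ℤ) ^ 2)
      = ((∏ j ∈ Finset.range i, (k - r - j * c ^ 2) : ℕ) : ℤ) := by
    rw [Nat.cast_prod]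
    refine Finset.prod_congr rfl fun j hj => ?_
    have hji : j * c ^ 2 ≤ k - r :=
      (Nat.mul_le_mul_right _ (Finset.mem_range.mp hj).le).trans hic
    rw [Nat.cast_sub hji, Nat.cast_sub hrk]
    push_cast
    ring
  have hcount' : ((∏ j ∈ Finset.range i, (k - r - j * c ^ 2) : ℕ) : ℤ)
      ≤ (D.card : ℤ) * (i.factorial : ℤ) := by exact_mod_cast hcount
  rw [hprod]
  calc _ ≤ (2 : ℤ) ^ r * K ^ 2 * ((D.card : ℤ) * (i.factorial : ℤ)) :=
        mul_le_mul_of_nonneg_left hcount' (by positivity)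
    _ = ((2 : ℤ) ^ r * K ^ 2 * (D.card : ℤ)) * (i.factorial : ℤ) := by ring
    _ ≤ (2 ^ k * (k.choose t : ℤ)) * (i.factorial : ℤ) :=
        mul_le_mul_of_nonneg_right hmain (by positivity)
    _ = _ := by ring
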